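/- arXiv:math/0411319 — 2 statements merged into one kernel-verified Lean document; each statement's English description precedes it below -/
import Mathlib

section
/- Let H be a real Hilbert space, let (α_i)_{i∈ℕ} be a Hilbert basis of H, and let (μ_i)_{i∈ℕ} be a sequence of nonzero real numbers such that |μ_0| < |μ_i| for all i ≠ 0. If β ∈ H satisfies |∑_{i∈ℕ} μ_i⁻¹ · ⟨α_i, β⟩²| = |μ_0|⁻¹ · ‖β‖², then β is a scalar multiple of α_0; more precisely β = ⟨α_0, β⟩ · α_0. -/
open scoped RealInnerProductSpace

/-- Equality case of the spectral inequality: if the helicity bound is attained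
and the first eigenvalue is simple in absolute value, then `β` is a multiple of
the principal eigenvector `α 0`. -/
theorem overtwisted_stmt1 {H : Type*} [NormedAddCommGroup H] [InnerProductSpace ℝ H]
    [CompleteSpace H] (α : HilbertBasis ℕ ℝ H) (μ : ℕ → ℝ)
    (hμ : ∀ i, μ i ≠ 0) (hmin : ∀ i, i ≠ 0 → |μ 0| < |μ i|) (β : H)
    (heq : |∑' i, (μ i)⁻¹ * ⟪α i, β⟫ ^ 2| = |μ 0|⁻¹ * ‖β‖ ^ 2) :
    β = ⟪α 0, β⟫ • α 0 := by
  have hP : HasSum (fun i => ⟪α i, β⟫ ^ 2) (‖β‖ ^ 2) := by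
    have h := α.hasSum_inner_mul_inner β β
    rw [real_inner_self_eq_norm_sq] at h
    have e : (fun i => ⟪α i, β⟫ ^ 2) = fun i => ⟪β, α i⟫ * ⟪α i, β⟫ := by
      funext i
      rw [real_inner_comm (α i) β, sq]
    rw [e]
    exact h
  have hQ : HasSum (fun i => |μ 0|⁻¹ * ⟪α i, β⟫ ^ 2) (|μ 0|⁻¹ * ‖β‖ ^ 2) := hP.mul_left _
  have h0 : 0 < |μ 0| := abs_pos.mpr (hμ 0)
  have hle : ∀ i, ‖(μ i)⁻¹ * ⟪α i, β⟫ ^ 2‖ ≤ |μ 0|⁻¹ * ⟪α i, β⟫ ^ 2 := by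
    intro i
    rw [Real.norm_eq_abs, abs_mul, abs_inv, abs_of_nonneg (sq_nonneg ⟪α i, β⟫)]
    refine mul_le_mul_of_nonneg_right ?_ (sq_nonneg _)
    rcases eq_or_ne i 0 with rfl | hi
    · exact le_rfl
    · exact inv_anti₀ h0 (hmin i hi).le
  have hS : Summable (fun i => ‖(μ i)⁻¹ * ⟪α i, β⟫ ^ 2‖) :=
    Summable.of_nonneg_of_le (fun _ => norm_nonneg _) hle hQ.summable
  have hz : ∀ j, j ≠ 0 → ⟪α j, β⟫ = 0 := by
    intro j hj
    by_contra hne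
    have hlt : ‖(μ j)⁻¹ * ⟪α j, β⟫ ^ 2‖ < |μ 0|⁻¹ * ⟪α j, β⟫ ^ 2 := by
      rw [Real.norm_eq_abs, abs_mul, abs_inv, abs_of_nonneg (sq_nonneg ⟪α j, β⟫)]
      exact mul_lt_mul_of_pos_right (inv_strictAnti₀ h0 (hmin j hj)) (by positivity)
    have h1 := Summable.tsum_lt_tsum hle hlt hS hQ.summable
    have h2 := norm_tsum_le_tsum_norm hS
    rw [hQ.tsum_eq] at h1
    rw [Real.norm_eq_abs, heq] at h2
    linarith
  have hR := α.hasSum_repr β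
  simp only [α.repr_apply_apply] at hR
  exact hR.unique (hasSum_single 0 fun j hj => by rw [hz j hj, zero_smul])
end

section
/- Let H be a real Hilbert space, let (α_i)_{i∈ℕ} be a Hilbert basis of H, let (μ_i)_{i∈ℕ} be a sequence of nonzero real numbers, and let λ > 0 be such that λ ≤ μ_i for every index i with μ_i > 0. Let β ∈ H be such that the family (μ_i⁻¹ · ⟨α_i, β⟩²)_{i∈ℕ} is summable, and set h := ∑_{i∈ℕ} μ_i⁻¹ · ⟨α_i, β⟩². If h > 0, then λ · h ≤ ‖β‖². -/
open scoped RealInnerProductSpace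

/-- Helicity estimate for K-contact minimizers: if `λ > 0` is a lower bound for
all positive eigenvalues `μ i` and the helicity `h = ∑ μ i⁻¹ ⟨α i, β⟩²` is
positive, then `λ · h ≤ ‖β‖²`. -/
theorem overtwisted_stmt8 {H : Type*} [NormedAddCommGroup H] [InnerProductSpace ℝ H]
    [CompleteSpace H] (α : HilbertBasis ℕ ℝ H) (μ : ℕ → ℝ)
    (hμ : ∀ i, μ i ≠ 0) (lam : ℝ) (hlam : 0 < lam)
    (hmin : ∀ i, 0 < μ i → lam ≤ μ i) (β : H)
    (hs : Summable (fun i => (μ i)⁻¹ * ⟪α i, β⟫ ^ 2))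
    (hpos : 0 < ∑' i, (μ i)⁻¹ * ⟪α i, β⟫ ^ 2) :
    lam * ∑' i, (μ i)⁻¹ * ⟪α i, β⟫ ^ 2 ≤ ‖β‖ ^ 2 := by
  have hP : HasSum (fun i => ⟪α i, β⟫ ^ 2) (‖β‖ ^ 2) := by
    have h := α.hasSum_inner_mul_inner β β
    rw [real_inner_self_eq_norm_sq] at h
    have e : (fun i => ⟪α i, β⟫ ^ 2) = fun i => ⟪β, α i⟫ * ⟪α i, β⟫ := by
      funext i
      rw [real_inner_comm (α i) β, sq]
    rw [e]
    exact h
  refine hasSum_le (fun i => ?_) (hs.hasSum.mul_left lam) hP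
  have hsq : 0 ≤ ⟪α i, β⟫ ^ 2 := sq_nonneg _
  have hc : lam * (μ i)⁻¹ ≤ 1 := by
    rcases lt_or_gt_of_ne (hμ i) with h | h
    · have := mul_neg_of_pos_of_neg hlam (inv_lt_zero.mpr h)
      linarith
    · rw [← div_eq_mul_inv, div_le_one h]
      exact hmin i h
  calc lam * ((μ i)⁻¹ * ⟪α i, β⟫ ^ 2) = (lam * (μ i)⁻¹) * ⟪α i, β⟫ ^ 2 := by ring
    _ ≤ 1 * ⟪α i, β⟫ ^ 2 := mul_le_mul_of_nonneg_right hc hsq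
    _ = ⟪α i, β⟫ ^ 2 := one_mul _
end
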